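/- arXiv:2510.17740 — 2 statements merged into one kernel-verified Lean document; each statement's English description precedes it below -/
import Mathlib

section
/- Let G = (V,E,η) be a β-balanced connected lossy flow graph whose smoothed graph has conductance at least φ, with |E| = m, and let d ∈ ℝ^V satisfy d_G ≤ d ≤ c·d_G for c ≥ 1, D = diag(d). Let λ = λ_min(D^{−1/2}L_G D^{−1/2}) with entrywise-positive unit eigenvector v, and set z_i = v_i/√(d_i). Suppose β < 0.1, φ < 0.1, cλ < 1, and β + cλ ≤ φ²/(100 log m). Then (max_i z_i)/(min_i z_i) ≤ exp(K·(β + cλ)·(log m)/φ²) for some absolute constant K. -/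
open Matrix

/-- Degree of a vertex `u` in the (smoothed, unweighted) multigraph with edge endpoint
maps `a b : E → V`. -/
def lossyDeg {V E : Type} [Fintype E] [DecidableEq V] (a b : E → V) (u : V) : ℕ :=
  (Finset.univ.filter (fun e => a e = u ∨ b e = u)).card

/-- Number of edges crossing the cut `(S, Sᶜ)` in the multigraph with endpoint maps
`a b : E → V`. -/
def lossyCut {V E : Type} [Fintype E] [DecidableEq V] (a b : E → V) (S : Finset V) : ℕ :=
  (Finset.univ.filter (fun e => (a e ∈ S ∧ b e ∉ S) ∨ (a e ∉ S ∧ b e ∈ S))).card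

section Volume

variable {V E : Type} [Fintype E] [DecidableEq V] {a b : E → V}

theorem sum_lossyDeg_mul (hab : ∀ e, a e ≠ b e) (S : Finset V) (f : V → ℝ) :
    ∑ u ∈ S, (lossyDeg a b u : ℝ) * f u =
      ∑ e, ((if a e ∈ S then f (a e) else 0) + if b e ∈ S then f (b e) else 0) := by
  have h : ∀ u, (lossyDeg a b u : ℝ) * f u =
      ∑ e, ((if a e = u then f u else 0) + if b e = u then f u else 0) := by
    intro u
    rw [lossyDeg, Finset.card_filter, Nat.cast_sum, Finset.sum_mul]
    refine Finset.sum_congr rfl fun e _ => ?_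
    by_cases h₁ : a e = u
    · have h₂ : b e ≠ u := fun h => hab e (h₁.trans h.symm)
      simp [h₁, h₂]
    · by_cases h₂ : b e = u <;> simp [h₁, h₂]
  simp_rw [h]
  rw [Finset.sum_comm]
  refine Finset.sum_congr rfl fun e _ => ?_
  rw [Finset.sum_add_distrib, Finset.sum_ite_eq, Finset.sum_ite_eq]

theorem sum_lossyDeg (hab : ∀ e, a e ≠ b e) (S : Finset V) :
    ∑ u ∈ S, (lossyDeg a b u : ℝ) =
      ∑ e, ((if a e ∈ S then 1 else 0) + if b e ∈ S then (1 : ℝ) else 0) := by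
  simpa using sum_lossyDeg_mul hab S fun _ => (1 : ℝ)

theorem sum_univ_lossyDeg [Fintype V] (hab : ∀ e, a e ≠ b e) :
    ∑ u, (lossyDeg a b u : ℝ) = 2 * Fintype.card E := by
  rw [sum_lossyDeg hab]
  simp only [Finset.mem_univ, if_true, Finset.sum_const, Finset.card_univ, nsmul_eq_mul]
  ring

theorem sum_lossyDeg_mono {S T : Finset V} (h : S ⊆ T) :
    ∑ u ∈ S, (lossyDeg a b u : ℝ) ≤ ∑ u ∈ T, (lossyDeg a b u : ℝ) :=
  Finset.sum_le_sum_of_subset_of_nonneg h fun _ _ _ => Nat.cast_nonneg _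

/-- If the edges leaving `S` have small total length with respect to `z`, then a set containing `S`
together with the endpoints of all short edges leaving `S` has substantially larger volume. -/
theorem sum_lossyDeg_growth (hab : ∀ e, a e ≠ b e) {S T : Finset V} (hST : S ⊆ T) {φ s : ℝ}
    (hs : 0 ≤ s) {z : V → ℝ} (hpos : 0 < φ * ∑ u ∈ S, (lossyDeg a b u : ℝ))
    (hcut : φ * ∑ u ∈ S, (lossyDeg a b u : ℝ) ≤ lossyCut a b S)
    (hgap : ∑ e with (a e ∈ S ∧ b e ∉ S) ∨ (a e ∉ S ∧ b e ∈ S), |z (a e) - z (b e)| ≤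
      s * (φ * ∑ u ∈ S, (lossyDeg a b u : ℝ)) / 2)
    (hshort : ∀ e, ((a e ∈ S ∧ b e ∉ S) ∨ (a e ∉ S ∧ b e ∈ S)) → |z (a e) - z (b e)| ≤ s →
      a e ∈ T ∧ b e ∈ T) :
    (1 + φ / 2) * ∑ u ∈ S, (lossyDeg a b u : ℝ) ≤ ∑ u ∈ T, (lossyDeg a b u : ℝ) := by
  have hpt : ∀ e, ((if a e ∈ S then 1 else 0) + (if b e ∈ S then (1 : ℝ) else 0)) +
      ((if ((a e ∈ S ∧ b e ∉ S) ∨ (a e ∉ S ∧ b e ∈ S)) ∧ |z (a e) - z (b e)| ≤ s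
        then 1 else 0 : ℕ) : ℝ) ≤
      (if a e ∈ T then 1 else 0) + if b e ∈ T then (1 : ℝ) else 0 := by
    intro e
    have ha := @hST (a e)
    have hb := @hST (b e)
    have he := hshort e
    clear hgap hcut hpos hshort
    by_cases h₁ : a e ∈ S <;> by_cases h₂ : b e ∈ S <;> by_cases h₃ : |z (a e) - z (b e)| ≤ s <;>
      simp only [h₁, h₂, h₃, not_true_eq_false, not_false_eq_true, and_true, and_false,
        or_true, or_false, or_self, forall_const, if_true, if_false, Nat.cast_zero,
        Nat.cast_one] at ha hb he ⊢ <;>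
      split_ifs <;> first | (norm_num; done) | (exfalso; tauto)
  set W := ∑ u ∈ S, (lossyDeg a b u : ℝ) with hW
  set C := Finset.univ.filter fun e => (a e ∈ S ∧ b e ∉ S) ∨ (a e ∉ S ∧ b e ∈ S) with hC
  have hcard : (lossyCut a b S : ℝ) = (C.filter fun e => |z (a e) - z (b e)| ≤ s).card +
      (C.filter fun e => ¬ |z (a e) - z (b e)| ≤ s).card := by
    rw [← Nat.cast_add, Finset.card_filter_add_card_filter_not]
    rfl
  set good := C.filter fun e => |z (a e) - z (b e)| ≤ s with hgood
  set bad := C.filter fun e => ¬ |z (a e) - z (b e)| ≤ s with hbad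
  have hbad_card : (bad.card : ℝ) ≤ φ * W / 2 := by
    by_contra! hlt
    have hne : bad.Nonempty := by
      rw [← Finset.card_pos, ← Nat.cast_pos (α := ℝ)]
      linarith
    have h₁ : ∑ _e ∈ bad, s < ∑ e ∈ bad, |z (a e) - z (b e)| :=
      Finset.sum_lt_sum_of_nonempty hne fun e he => not_le.1 (Finset.mem_filter.1 he).2
    have h₂ : ∑ e ∈ bad, |z (a e) - z (b e)| ≤ ∑ e ∈ C, |z (a e) - z (b e)| :=
      Finset.sum_le_sum_of_subset_of_nonneg (Finset.filter_subset _ _) fun _ _ _ => abs_nonneg _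
    rw [Finset.sum_const, nsmul_eq_mul] at h₁
    nlinarith
  have hgood_card : W + good.card ≤ ∑ u ∈ T, (lossyDeg a b u : ℝ) := by
    rw [hW, sum_lossyDeg hab, sum_lossyDeg hab, hgood, hC, Finset.filter_filter,
      Finset.card_filter, Nat.cast_sum, ← Finset.sum_add_distrib]
    exact Finset.sum_le_sum fun e _ => hpt e
  linarith

/-- If all edges of the graph given by the endpoint maps `a b` come from a connected graph on at
least two vertices, every vertex has positive degree. -/
theorem one_le_lossyDeg [Nontrivial V]
    (hconn : (SimpleGraph.fromRel (fun u v => ∃ e, a e = u ∧ b e = v)).Connected) (u : V) :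
    (1 : ℝ) ≤ lossyDeg a b u := by
  obtain ⟨w, hw⟩ := hconn.preconnected.exists_adj_of_nontrivial u
  rw [SimpleGraph.fromRel_adj] at hw
  rw [Nat.one_le_cast, lossyDeg, Nat.succ_le_iff, Finset.card_pos]
  obtain ⟨-, ⟨e, he, -⟩ | ⟨e, -, he⟩⟩ := hw
  · exact ⟨e, by simp [he]⟩
  · exact ⟨e, by simp [he]⟩

end Volume

theorem lt_of_geometric_growth {W : ℕ → ℝ} {Q : ℕ → Prop} {m r : ℝ} (hr : 0 ≤ r)
    (hW : Monotone W) (h₀ : 1 ≤ W 0) (hQ₀ : Q 0)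
    (hstep : ∀ k, W k ≤ m → Q k → r * W k ≤ W (k + 1) ∧ Q (k + 1)) {N : ℕ} (hN : m < r ^ N) :
    m < W N := by
  have key : ∀ k, m < W k ∨ (r ^ k ≤ W k ∧ Q k) := by
    intro k
    induction k with
    | zero => exact Or.inr ⟨by simpa using h₀, hQ₀⟩
    | succ k ih =>
      by_cases hk : m < W k
      · exact Or.inl (hk.trans_le (hW k.le_succ))
      · obtain ⟨h₁, h₂⟩ := ih.resolve_left hk
        obtain ⟨h₃, h₄⟩ := hstep k (not_lt.1 hk) h₂
        refine Or.inr ⟨le_trans ?_ h₃, h₄⟩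
        rw [pow_succ']
        exact mul_le_mul_of_nonneg_left h₁ hr
  rcases key N with h | h
  · exact h
  · exact hN.trans_le h.1

section Incidence

variable {V E : Type} [DecidableEq V] {a b : E → V} {η : E → ℝ} {BG : Matrix E V ℝ}

theorem lossyIncidence_mulVec [Fintype V]
    (hB : ∀ e v, BG e v = (if v = b e then 1 else 0) - η e * (if v = a e then 1 else 0))
    (z : V → ℝ) (e : E) : BG.mulVec z e = z (b e) - η e * z (a e) := by
  simp [Matrix.mulVec, dotProduct, hB, sub_mul, Finset.sum_sub_distrib]

theorem sum_lossyLaplacian_mulVec [Fintype V] [Fintype E]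
    (hB : ∀ e v, BG e v = (if v = b e then 1 else 0) - η e * (if v = a e then 1 else 0))
    (z : V → ℝ) (S : Finset V) :
    ∑ u ∈ S, (BGᵀ * BG).mulVec z u =
      ∑ e, (z (b e) - η e * z (a e)) *
        ((if b e ∈ S then 1 else 0) - η e * (if a e ∈ S then 1 else 0)) := by
  simp_rw [← Matrix.mulVec_mulVec, Matrix.mulVec_transpose, Matrix.vecMul, dotProduct,
    lossyIncidence_mulVec hB]
  rw [Finset.sum_comm]
  refine Finset.sum_congr rfl fun e _ => ?_
  rw [← Finset.mul_sum]
  simp [hB, Finset.sum_sub_distrib]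

theorem lossyLaplacian_diag_bounds [Fintype E] (hab : ∀ e, a e ≠ b e)
    (hB : ∀ e v, BG e v = (if v = b e then 1 else 0) - η e * (if v = a e then 1 else 0))
    {β : ℝ} (hη : ∀ e, 1 ≤ η e ∧ η e ≤ 1 + β) (u : V) :
    (lossyDeg a b u : ℝ) ≤ (BGᵀ * BG) u u ∧
      (BGᵀ * BG) u u ≤ (1 + β) ^ 2 * lossyDeg a b u := by
  have hterm : ∀ e, (if a e = u ∨ b e = u then (1 : ℝ) else 0) ≤ BG e u * BG e u ∧
      BG e u * BG e u ≤ (1 + β) ^ 2 * (if a e = u ∨ b e = u then (1 : ℝ) else 0) := by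
    intro e
    obtain ⟨h₁, h₂⟩ := hη e
    rw [hB]
    by_cases ha : a e = u
    · have hb : b e ≠ u := fun h => hab e (ha.trans h.symm)
      simp only [ha, hb.symm, true_or, if_true, if_false]
      constructor <;> nlinarith
    · by_cases hb : b e = u
      · simp only [hb, Ne.symm ha, or_true, if_true, if_false]
        constructor <;> nlinarith
      · simp [Ne.symm ha, Ne.symm hb, ha, hb]
  rw [lossyDeg, Finset.card_filter, Nat.cast_sum, Matrix.mul_apply, Finset.mul_sum]
  push_cast
  exact ⟨Finset.sum_le_sum fun e _ => (hterm e).1, Finset.sum_le_sum fun e _ => (hterm e).2⟩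

/-- On a superlevel set of `z`, the total length of the leaving edges is controlled by the weighted
volume of the set. -/
theorem sum_cut_le_of_superlevel [Fintype V] [Fintype E] (hab : ∀ e, a e ≠ b e)
    (hB : ∀ e v, BG e v = (if v = b e then 1 else 0) - η e * (if v = a e then 1 else 0))
    {β : ℝ} (hβ : 0 ≤ β) (hη : ∀ e, 1 ≤ η e ∧ η e ≤ 1 + β) {z : V → ℝ} (hz : ∀ u, 0 < z u)
    {S : Finset V} (hS : ∀ u ∈ S, ∀ w ∉ S, z w ≤ z u) :
    ∑ e with (a e ∈ S ∧ b e ∉ S) ∨ (a e ∉ S ∧ b e ∈ S), |z (a e) - z (b e)| ≤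
      ∑ u ∈ S, (BGᵀ * BG).mulVec z u + β * ∑ u ∈ S, (lossyDeg a b u : ℝ) * z u := by
  rw [sum_lossyLaplacian_mulVec hB, sum_lossyDeg_mul hab, Finset.mul_sum,
    ← Finset.sum_add_distrib, Finset.sum_filter]
  refine Finset.sum_le_sum fun e _ => ?_
  obtain ⟨h₁, h₂⟩ := hη e
  have hza := hz (a e)
  have hzb := hz (b e)
  have h₃ := mul_nonneg (sub_nonneg.2 h₁) hza.le
  have h₄ := mul_nonneg (sub_nonneg.2 h₂) hza.le
  have h₅ := mul_nonneg (sub_nonneg.2 h₂) hzb.le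
  have h₆ := mul_nonneg hβ hza.le
  by_cases ha : a e ∈ S <;> by_cases hb : b e ∈ S
  · simp only [ha, hb, not_true_eq_false, and_false, false_and, or_false, if_true, if_false]
    nlinarith [mul_nonneg (sub_nonneg.2 h₁) h₃]
  · have hle := hS _ ha _ hb
    simp only [ha, hb, not_true_eq_false, not_false_eq_true, and_true, and_false, or_false,
      if_true, if_false]
    rw [abs_of_nonneg (sub_nonneg.2 hle)]
    nlinarith [mul_nonneg (sub_nonneg.2 h₁) h₃, mul_nonneg (sub_nonneg.2 h₁) (sub_nonneg.2 hle)]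
  · have hle := hS _ hb _ ha
    simp only [ha, hb, not_true_eq_false, not_false_eq_true, and_true, and_false, or_true,
      if_true, if_false]
    rw [abs_of_nonpos (sub_nonpos.2 hle)]
    nlinarith [mul_nonneg hβ (sub_nonneg.2 hle)]
  · simp [ha, hb]

/-- On a sublevel set of `z`, the total length of the leaving edges is controlled by the weighted
volume of the set. -/
theorem sum_cut_le_of_sublevel [Fintype V] [Fintype E] (hab : ∀ e, a e ≠ b e)
    (hB : ∀ e v, BG e v = (if v = b e then 1 else 0) - η e * (if v = a e then 1 else 0))
    {β : ℝ} (hβ : 0 ≤ β) (hη : ∀ e, 1 ≤ η e ∧ η e ≤ 1 + β) {z : V → ℝ} (hz : ∀ u, 0 < z u)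
    {S : Finset V} (hS : ∀ u ∈ S, ∀ w ∉ S, z u ≤ z w) :
    ∑ e with (a e ∈ S ∧ b e ∉ S) ∨ (a e ∉ S ∧ b e ∈ S), |z (a e) - z (b e)| ≤
      (1 + β) * β * ∑ u ∈ S, (lossyDeg a b u : ℝ) * z u -
        ∑ u ∈ S, (BGᵀ * BG).mulVec z u := by
  rw [sum_lossyLaplacian_mulVec hB, sum_lossyDeg_mul hab, Finset.mul_sum,
    ← Finset.sum_sub_distrib, Finset.sum_filter]
  refine Finset.sum_le_sum fun e _ => ?_
  obtain ⟨h₁, h₂⟩ := hη e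
  have hza := hz (a e)
  have hzb := hz (b e)
  have h₃ := mul_nonneg (sub_nonneg.2 h₁) hza.le
  have h₄ := mul_nonneg (sub_nonneg.2 h₁) hzb.le
  have h₅ : (η e - 1) * η e ≤ (1 + β) * β := by nlinarith
  have h₆ := mul_le_mul_of_nonneg_right h₅ hza.le
  have h₇ : 0 ≤ (1 + β) * β * z (b e) := by positivity
  by_cases ha : a e ∈ S <;> by_cases hb : b e ∈ S
  · simp only [ha, hb, not_true_eq_false, and_false, false_and, or_false, if_true, if_false]
    nlinarith
  · have hle := hS _ ha _ hb
    simp only [ha, hb, not_true_eq_false, not_false_eq_true, and_true, and_false, or_false,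
      if_true, if_false]
    rw [abs_of_nonpos (sub_nonpos.2 hle)]
    nlinarith
  · have hle := hS _ hb _ ha
    simp only [ha, hb, not_true_eq_false, not_false_eq_true, and_true, and_false, or_true,
      if_true, if_false]
    rw [abs_of_nonneg (sub_nonneg.2 hle)]
    nlinarith
  · simp [ha, hb]

end Incidence

/-- If every level set of `z` has leaving edges of total length at most `κ` times its weighted
volume, and the graph has conductance at least `φ`, then `z` is nearly constant. -/
theorem max_le_mul_of_cut_le {V E : Type} [Fintype V] [Fintype E] [DecidableEq V] {a b : E → V}
    (hab : ∀ e, a e ≠ b e) (hdeg : ∀ u, (1 : ℝ) ≤ lossyDeg a b u) {φ : ℝ} (hφ : 0 < φ)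
    (hφ₁ : φ < 1) (hcond : ∀ S : Finset V,
        φ * min (∑ u ∈ S, (lossyDeg a b u : ℝ)) (∑ u ∈ Sᶜ, (lossyDeg a b u : ℝ)) ≤
          (lossyCut a b S : ℝ))
    {z : V → ℝ} (hz : ∀ u, 0 < z u) {κ δ : ℝ} (hδ₀ : 0 ≤ δ) (hδ : 4 * κ = δ * φ)
    (hδφ : 8 * δ ≤ φ)
    (hhigh : ∀ S : Finset V, (∀ u ∈ S, ∀ w ∉ S, z w ≤ z u) →
      ∑ e with (a e ∈ S ∧ b e ∉ S) ∨ (a e ∉ S ∧ b e ∈ S), |z (a e) - z (b e)| ≤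
        κ * ∑ u ∈ S, (lossyDeg a b u : ℝ) * z u)
    (hlow : ∀ S : Finset V, (∀ u ∈ S, ∀ w ∉ S, z u ≤ z w) →
      ∑ e with (a e ∈ S ∧ b e ∉ S) ∨ (a e ∉ S ∧ b e ∈ S), |z (a e) - z (b e)| ≤
        κ * ∑ u ∈ S, (lossyDeg a b u : ℝ) * z u)
    {N : ℕ} (hN : (Fintype.card E : ℝ) < (1 + φ / 2) ^ N) (i j : V) :
    (1 - δ) ^ N * z i ≤ (1 + δ) ^ N * z j := by
  have hκ : 0 ≤ κ := by nlinarith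
  have hδ₁ : 0 < 1 - δ := by linarith
  have htot : ∀ S : Finset V, ∑ u ∈ S, (lossyDeg a b u : ℝ) + ∑ u ∈ Sᶜ, (lossyDeg a b u : ℝ) =
      2 * Fintype.card E := fun S => by
    rw [Finset.sum_add_sum_compl, sum_univ_lossyDeg hab]
  have hcut : ∀ S : Finset V, ∑ u ∈ S, (lossyDeg a b u : ℝ) ≤ Fintype.card E →
      φ * ∑ u ∈ S, (lossyDeg a b u : ℝ) ≤ lossyCut a b S := fun S hS => by
    have h := hcond S
    rwa [min_eq_left (by linarith [htot S])] at h
  have hvol : ∀ S : Finset V, ∀ u ∈ S, 1 ≤ ∑ u ∈ S, (lossyDeg a b u : ℝ) := fun S u hu =>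
    (hdeg u).trans (Finset.single_le_sum (f := fun u => (lossyDeg a b u : ℝ))
      (fun _ _ => Nat.cast_nonneg _) hu)
  have : Nonempty V := ⟨i⟩
  obtain ⟨p, hp⟩ := Finite.exists_max z
  -- sublevel sets, starting from `z j`
  let T : ℕ → Finset V := fun k => Finset.univ.filter fun u => z u ≤ (1 + δ) ^ k * z j
  have hTmem : ∀ k u, u ∈ T k ↔ z u ≤ (1 + δ) ^ k * z j := fun k u => by simp [T]
  have hTmono : Monotone T := by
    refine monotone_nat_of_le_succ fun k u hu => ?_
    rw [hTmem] at hu ⊢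
    have : 0 ≤ (1 + δ) ^ k * z j := by have := hz j; positivity
    rw [pow_succ]
    nlinarith
  have hTj : ∀ k, j ∈ T k := fun k => hTmono (Nat.zero_le k) (by simp [hTmem])
  have hTN : (Fintype.card E : ℝ) < ∑ u ∈ T N, (lossyDeg a b u : ℝ) := by
    refine lt_of_geometric_growth (W := fun k => ∑ u ∈ T k, (lossyDeg a b u : ℝ))
      (Q := fun _ => True) (by positivity) (fun k l h => sum_lossyDeg_mono (hTmono h))
      (hvol _ _ (hTj 0)) trivial (fun k hk _ => ⟨?_, trivial⟩) hN
    have ht : 0 < (1 + δ) ^ k * z j := by have := hz j; positivity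
    have hW := hvol _ _ (hTj k)
    refine sum_lossyDeg_growth hab (hTmono k.le_succ) (s := δ * ((1 + δ) ^ k * z j))
      (z := z) (by positivity) (by positivity) (hcut _ hk) ?_ ?_
    · refine (hlow (T k) fun u hu w hw => ?_).trans ?_
      · rw [hTmem] at hu hw
        exact hu.trans (not_le.1 hw).le
      · have hμ : ∑ u ∈ T k, (lossyDeg a b u : ℝ) * z u ≤
            (∑ u ∈ T k, (lossyDeg a b u : ℝ)) * ((1 + δ) ^ k * z j) := by
          rw [Finset.sum_mul]
          exact Finset.sum_le_sum fun u hu =>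
            mul_le_mul_of_nonneg_left ((hTmem k u).1 hu) (Nat.cast_nonneg _)
        have h₁ := mul_le_mul_of_nonneg_left hμ hκ
        have h₂ : 0 ≤ κ * ((∑ u ∈ T k, (lossyDeg a b u : ℝ)) * ((1 + δ) ^ k * z j)) := by positivity
        have h₃ : δ * ((1 + δ) ^ k * z j) * (φ * ∑ u ∈ T k, (lossyDeg a b u : ℝ)) / 2 =
            2 * (κ * ((∑ u ∈ T k, (lossyDeg a b u : ℝ)) * ((1 + δ) ^ k * z j))) := by
          linear_combination (-((1 + δ) ^ k * z j) * (∑ u ∈ T k, (lossyDeg a b u : ℝ)) / 2) * hδ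
        linarith
    · intro e he hle
      rw [abs_le] at hle
      simp only [hTmem, pow_succ] at he ⊢
      have h₀ : 0 ≤ δ * ((1 + δ) ^ k * z j) := by positivity
      rcases he with ⟨h₁, -⟩ | ⟨-, h₁⟩ <;> constructor <;> nlinarith
  -- superlevel sets, starting from the maximum
  let S : ℕ → Finset V := fun k => Finset.univ.filter fun u => (1 - δ) ^ k * z p ≤ z u
  have hSmem : ∀ k u, u ∈ S k ↔ (1 - δ) ^ k * z p ≤ z u := fun k u => by simp [S]
  have ht : ∀ k, 0 < (1 - δ) ^ k * z p := fun k => mul_pos (pow_pos hδ₁ k) (hz p)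
  have hSmono : Monotone S := by
    refine monotone_nat_of_le_succ fun k u hu => ?_
    rw [hSmem] at hu ⊢
    have := ht k
    rw [pow_succ]
    nlinarith
  have hSp : ∀ k, p ∈ S k := fun k => hSmono (Nat.zero_le k) (by simp [hSmem])
  have hSN : (Fintype.card E : ℝ) < ∑ u ∈ S N, (lossyDeg a b u : ℝ) := by
    refine lt_of_geometric_growth (W := fun k => ∑ u ∈ S k, (lossyDeg a b u : ℝ))
      (Q := fun k => ∑ u ∈ S k, (lossyDeg a b u : ℝ) * z u ≤
        2 * ((1 - δ) ^ k * z p) * ∑ u ∈ S k, (lossyDeg a b u : ℝ))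
      (by positivity) (fun k l h => sum_lossyDeg_mono (hSmono h)) (hvol _ _ (hSp 0)) ?_
      (fun k hk hμ => ?_) hN
    · rw [Finset.mul_sum]
      refine Finset.sum_le_sum fun u _ => ?_
      have h₁ : (0 : ℝ) ≤ lossyDeg a b u := Nat.cast_nonneg _
      have h₂ := mul_le_mul_of_nonneg_left (hp u) h₁
      have h₃ := mul_nonneg h₁ (hz p).le
      rw [pow_zero]
      linarith
    · have htk := ht k
      have hW := hvol _ _ (hSp k)
      have hgrow : (1 + φ / 2) * ∑ u ∈ S k, (lossyDeg a b u : ℝ) ≤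
          ∑ u ∈ S (k + 1), (lossyDeg a b u : ℝ) := by
        refine sum_lossyDeg_growth hab (hSmono k.le_succ) (s := δ * ((1 - δ) ^ k * z p))
          (z := z) (by positivity) (by positivity) (hcut _ hk) ?_ ?_
        · refine (hhigh (S k) fun u hu w hw => ?_).trans ?_
          · rw [hSmem] at hu hw
            exact (not_le.1 hw).le.trans hu
          · refine (mul_le_mul_of_nonneg_left hμ hκ).trans_eq ?_
            linear_combination
              (((1 - δ) ^ k * z p) * (∑ u ∈ S k, (lossyDeg a b u : ℝ)) / 2) * hδ
        · intro e he hle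
          rw [abs_le] at hle
          simp only [hSmem, pow_succ] at he ⊢
          have h₀ : 0 ≤ δ * ((1 - δ) ^ k * z p) := by positivity
          rcases he with ⟨h₁, -⟩ | ⟨-, h₁⟩ <;> constructor <;> nlinarith
      refine ⟨hgrow, ?_⟩
      have hnew : ∑ u ∈ S (k + 1) \ S k, (lossyDeg a b u : ℝ) * z u ≤
          (∑ u ∈ S (k + 1) \ S k, (lossyDeg a b u : ℝ)) * ((1 - δ) ^ k * z p) := by
        rw [Finset.sum_mul]
        refine Finset.sum_le_sum fun u hu => mul_le_mul_of_nonneg_left ?_ (Nat.cast_nonneg _)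
        have h := (Finset.mem_sdiff.1 hu).2
        rw [hSmem] at h
        exact (not_le.1 h).le
      rw [← Finset.sum_sdiff (hSmono k.le_succ)] at hgrow ⊢
      have hsum := Finset.sum_sdiff (f := fun u => (lossyDeg a b u : ℝ)) (hSmono k.le_succ)
      rw [← hsum, pow_succ]
      set X := ∑ u ∈ S (k + 1) \ S k, (lossyDeg a b u : ℝ)
      set Y := ∑ u ∈ S k, (lossyDeg a b u : ℝ)
      have hXY : 2 * δ * (X + Y) ≤ X := by
        have hY : 0 ≤ φ * Y := by positivity
        have hX : 0 ≤ X := by linarith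
        have h₁ := mul_le_mul_of_nonneg_right hδφ (show 0 ≤ X + Y by linarith)
        have h₂ := mul_le_mul_of_nonneg_right hφ₁.le hX
        linarith
      have := mul_le_mul_of_nonneg_left hXY htk.le
      nlinarith
  -- both sets carry more than half of the volume, so they meet
  obtain ⟨x, hxS, hxT⟩ : ∃ x, x ∈ S N ∧ x ∈ T N := by
    by_contra! hdisj
    have hsub : T N ⊆ (S N)ᶜ := fun x hx => Finset.mem_compl.2 fun h => hdisj x h hx
    linarith [htot (S N), sum_lossyDeg_mono (a := a) (b := b) hsub]
  rw [hSmem] at hxS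
  rw [hTmem] at hxT
  exact (mul_le_mul_of_nonneg_left (hp i) (pow_nonneg hδ₁.le N)).trans (hxS.trans hxT)

/-- The number of growth steps by a factor `1 + φ / 2` needed to exceed `m`. -/
theorem exists_nat_lt_one_add_pow {φ m : ℝ} (hφ : 0 < φ) (hφ₁ : φ < 0.1) (hm : 1 ≤ m) :
    ∃ N : ℕ, m < (1 + φ / 2) ^ N ∧ (N : ℝ) ≤ 2.1 * Real.log m / φ + 1 := by
  have hlog : φ / 2.1 ≤ Real.log (1 + φ / 2) := by
    have h := Real.one_sub_inv_le_log_of_pos (show 0 < 1 + φ / 2 by positivity)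
    refine le_trans ?_ h
    rw [← sub_nonneg]
    have : 1 - (1 + φ / 2)⁻¹ - φ / 2.1 = φ * (0.1 - φ) / (4.2 * (1 + φ / 2)) := by
      field_simp
      ring
    rw [this]
    have : 0 < 0.1 - φ := by linarith
    positivity
  have hlog₀ : 0 < Real.log (1 + φ / 2) := lt_of_lt_of_le (by positivity) hlog
  have hlm := Real.log_nonneg hm
  refine ⟨⌊Real.log m / Real.log (1 + φ / 2)⌋₊ + 1, ?_, ?_⟩
  · rw [← Real.log_lt_log_iff (by linarith) (by positivity), Real.log_pow]
    push_cast
    rw [← div_lt_iff₀ hlog₀]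
    exact Nat.lt_floor_add_one _
  · push_cast
    have h₁ := Nat.floor_le (div_nonneg hlm hlog₀.le)
    have h₂ : Real.log m / Real.log (1 + φ / 2) ≤ Real.log m / (φ / 2.1) := by gcongr
    have h₃ : Real.log m / (φ / 2.1) = 2.1 * Real.log m / φ := by field_simp
    linarith

/-- uniformity of the bottom eigenvector. There is an absolute constant
`K > 0` such that: for every `β`-balanced connected lossy flow graph `G` whose smoothed
graph has conductance at least `φ`, with `m = |E|`, `d_G ≤ d ≤ c·d_G` (`c ≥ 1`),
`λ = λ_min(D^{-1/2}L_G D^{-1/2})` with entrywise-positive unit eigenvector `v`, and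
`z = D^{-1/2}v`, if `β < 0.1`, `φ < 0.1`, `cλ < 1` and `β + cλ ≤ φ²/(100 log m)`, then
`max z / min z ≤ exp(K(β + cλ)(log m)/φ²)`, i.e. `z i ≤ exp(…) · z j` for all `i, j`. -/
theorem stmt_14 :
    ∃ K : ℝ, 0 < K ∧
      ∀ (V E : Type) [Fintype V] [Fintype E] [DecidableEq V],
      ∀ (a b : E → V), (∀ e, a e ≠ b e) →
      ∀ (β : ℝ), 0 ≤ β →
      ∀ (η : E → ℝ), (∀ e, 1 ≤ η e ∧ η e ≤ 1 + β) →
      (SimpleGraph.fromRel (fun u v => ∃ e, a e = u ∧ b e = v)).Connected →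
      ∀ (φ : ℝ), 0 < φ →
      (∀ S : Finset V,
        φ * min (∑ u ∈ S, (lossyDeg a b u : ℝ)) (∑ u ∈ Sᶜ, (lossyDeg a b u : ℝ)) ≤
          (lossyCut a b S : ℝ)) →
      ∀ (BG : Matrix E V ℝ),
        (∀ e v, BG e v = (if v = b e then 1 else 0) - η e * (if v = a e then 1 else 0)) →
      ∀ (LG : Matrix V V ℝ), LG = BGᵀ * BG →
      ∀ (c : ℝ), 1 ≤ c →
      ∀ (d : V → ℝ), (∀ u, LG u u ≤ d u ∧ d u ≤ c * LG u u) →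
      ∀ (M : Matrix V V ℝ),
        (∀ u v, M u v = LG u v / (Real.sqrt (d u) * Real.sqrt (d v))) →
      ∀ (lam : ℝ) (v : V → ℝ),
        M.mulVec v = lam • v → v ⬝ᵥ v = 1 → (∀ i, 0 < v i) →
        (∀ x : V → ℝ, lam * (x ⬝ᵥ x) ≤ x ⬝ᵥ M.mulVec x) →
      ∀ (z : V → ℝ), (∀ i, z i = v i / Real.sqrt (d i)) →
      β < 0.1 → φ < 0.1 → c * lam < 1 →
      β + c * lam ≤ φ ^ 2 / (100 * Real.log (Fintype.card E)) →
      ∀ i j, z i ≤ Real.exp (K * (β + c * lam) * Real.log (Fintype.card E) / φ ^ 2) * z j := by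
  refine ⟨60, by norm_num, ?_⟩
  intro V E _ _ _ a b hab β hβ η hη hconn φ hφ hcond BG hB LG hLG c hc d hd M hM lam v hMv hvv hv _
    z hz hβ₁ hφ₁ _ hsmall i j
  rcases subsingleton_or_nontrivial V with hV | hV
  · have : IsEmpty E := ⟨fun e => hab e (Subsingleton.elim _ _)⟩
    simp [Subsingleton.elim i j]
  have hdeg := one_le_lossyDeg hconn
  have hLdiag := fun u => hLG ▸ lossyLaplacian_diag_bounds hab hB hη u
  have hdpos : ∀ u, 0 < d u := fun u => by linarith [hdeg u, (hLdiag u).1, (hd u).1]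
  have hzpos : ∀ u, 0 < z u := fun u => by
    rw [hz]
    exact div_pos (hv u) (Real.sqrt_pos.2 (hdpos u))
  have hvz : ∀ u, v u = Real.sqrt (d u) * z u := fun u => by
    rw [hz, mul_div_cancel₀ _ (Real.sqrt_pos.2 (hdpos u)).ne']
  have heig : ∀ u, LG.mulVec z u = lam * (d u * z u) := fun u => by
    have h := congrFun hMv u
    have hs := Real.sqrt_pos.2 (hdpos u)
    have h₁ : M.mulVec v u = LG.mulVec z u / Real.sqrt (d u) := by
      simp only [Matrix.mulVec, dotProduct, Finset.sum_div]
      refine Finset.sum_congr rfl fun w _ => ?_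
      have := Real.sqrt_pos.2 (hdpos w)
      rw [hM, hvz]
      field_simp
    rw [h₁, Pi.smul_apply, smul_eq_mul, hvz, div_eq_iff hs.ne'] at h
    rw [h]
    nth_rewrite 3 [← Real.mul_self_sqrt (hdpos u).le]
    ring
  have hlam : 0 ≤ lam := by
    have h₁ : 0 ≤ z ⬝ᵥ LG.mulVec z := by
      rw [hLG, ← Matrix.mulVec_mulVec, Matrix.dotProduct_mulVec, Matrix.vecMul_transpose]
      exact Finset.sum_nonneg fun _ _ => mul_self_nonneg _
    have h₂ : z ⬝ᵥ LG.mulVec z = lam * ∑ u, z u * (d u * z u) := by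
      simp only [dotProduct, heig, Finset.mul_sum]
      exact Finset.sum_congr rfl fun u _ => by ring
    have h₃ : 0 < ∑ u, z u * (d u * z u) := Finset.sum_pos
      (fun u _ => mul_pos (hzpos u) (mul_pos (hdpos u) (hzpos u))) ⟨i, Finset.mem_univ i⟩
    rw [h₂] at h₁
    exact nonneg_of_mul_nonneg_left h₁ h₃
  have hcl : 0 ≤ c * lam := by positivity
  set ε := β + c * lam with hε
  have hε₀ : 0 ≤ ε := by positivity
  have hsq : (1 + β) ^ 2 ≤ 1.21 := by nlinarith
  have hsum₀ : ∀ S : Finset V, 0 ≤ ∑ u ∈ S, LG.mulVec z u := fun S =>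
    Finset.sum_nonneg fun u _ => by
      rw [heig]
      exact mul_nonneg hlam (mul_nonneg (hdpos u).le (hzpos u).le)
  have hμ₀ : ∀ S : Finset V, 0 ≤ ∑ u ∈ S, (lossyDeg a b u : ℝ) * z u := fun S =>
    Finset.sum_nonneg fun u _ => mul_nonneg (Nat.cast_nonneg _) (hzpos u).le
  have hsum₁ : ∀ S : Finset V, ∑ u ∈ S, LG.mulVec z u ≤
      1.21 * (c * lam) * ∑ u ∈ S, (lossyDeg a b u : ℝ) * z u := fun S => by
    rw [Finset.mul_sum]
    refine Finset.sum_le_sum fun u _ => ?_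
    have h₁ : d u ≤ c * (1.21 * lossyDeg a b u) :=
      (hd u).2.trans (mul_le_mul_of_nonneg_left ((hLdiag u).2.trans
        (mul_le_mul_of_nonneg_right hsq (Nat.cast_nonneg _))) (by linarith))
    have h₂ := mul_le_mul_of_nonneg_left (mul_le_mul_of_nonneg_right h₁ (hzpos u).le) hlam
    rw [heig]
    linarith
  have hcard : (1 : ℝ) ≤ Fintype.card E := by
    have h := sum_univ_lossyDeg (V := V) hab
    have h₁ : (0 : ℝ) < ∑ u, (lossyDeg a b u : ℝ) :=
      Finset.sum_pos (fun u _ => by linarith [hdeg u]) ⟨i, Finset.mem_univ i⟩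
    have h₂ : (0 : ℝ) < Fintype.card E := by linarith
    exact_mod_cast h₂
  set l := Real.log (Fintype.card E) with hl
  have hεl : ε = 0 ∨ 0.69 ≤ l := by
    rcases hcard.eq_or_lt with h | h
    · left
      rw [hl, ← h, Real.log_one, mul_zero, div_zero] at hsmall
      exact le_antisymm hsmall hε₀
    · right
      have h₂ : (2 : ℝ) ≤ Fintype.card E := by
        have : 1 < Fintype.card E := by exact_mod_cast h
        exact_mod_cast this
      have := Real.log_le_log (by norm_num) h₂
      linarith [Real.log_two_gt_d9]
  have hεφ : 69 * ε ≤ φ ^ 2 := by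
    rcases hεl with h | h
    · rw [h]
      nlinarith
    · rw [le_div_iff₀ (by positivity)] at hsmall
      nlinarith
  obtain ⟨N, hN, hNle⟩ := exists_nat_lt_one_add_pow hφ hφ₁ hcard
  have hεN : ε * N ≤ 4 * ε * l / φ := by
    rcases hεl with h | h
    · simp [h]
    · have h₁ : 1 ≤ l / φ := by
        rw [le_div_iff₀ hφ]
        linarith
      have h₂ : (N : ℝ) ≤ 4 * (l / φ) := by
        have : 2.1 * l / φ = 2.1 * (l / φ) := by ring
        linarith
      calc ε * N ≤ ε * (4 * (l / φ)) := mul_le_mul_of_nonneg_left h₂ hε₀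
        _ = 4 * ε * l / φ := by ring
  set δ := 4.84 * ε / φ with hδ
  have hδφ : δ * φ = 4.84 * ε := div_mul_cancel₀ _ hφ.ne'
  have hδ₀ : 0 ≤ δ := by positivity
  have hδ₁ : 8 * δ ≤ φ := by
    refine le_of_mul_le_mul_right ?_ hφ
    nlinarith
  have hmain := max_le_mul_of_cut_le (κ := 1.21 * ε) (δ := δ) hab hdeg hφ (by linarith) hcond
    hzpos hδ₀ (by linarith) hδ₁
    (fun S hS => by
      have h₁ := sum_cut_le_of_superlevel hab hB hβ hη hzpos hS
      rw [← hLG] at h₁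
      have h₂ := hsum₁ S
      have h₃ := mul_nonneg hβ (hμ₀ S)
      rw [hε]
      linarith)
    (fun S hS => by
      have h₁ := sum_cut_le_of_sublevel hab hB hβ hη hzpos hS
      rw [← hLG] at h₁
      have h₂ := hsum₀ S
      have h₃ : (1 + β) * β ≤ 1.21 * ε := by nlinarith
      have h₄ := mul_le_mul_of_nonneg_right h₃ (hμ₀ S)
      linarith) hN i j
  have hratio : (1 + δ) ^ N ≤ (1 - δ) ^ N * Real.exp (N * (3 * δ)) := by
    rw [Real.exp_nat_mul, ← mul_pow]
    refine pow_le_pow_left₀ (by linarith) ?_ N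
    have h := mul_le_mul_of_nonneg_left (Real.add_one_le_exp (3 * δ))
      (show 0 ≤ 1 - δ by linarith)
    nlinarith
  have hfin : z i ≤ Real.exp (N * (3 * δ)) * z j := by
    refine le_of_mul_le_mul_left ?_ (pow_pos (show 0 < 1 - δ by linarith) N)
    have := mul_le_mul_of_nonneg_right hratio (hzpos j).le
    linarith
  refine hfin.trans (mul_le_mul_of_nonneg_right (Real.exp_le_exp.2 ?_) (hzpos j).le)
  have h₁ : N * (3 * δ) = 14.52 / φ * (ε * N) := by
    rw [hδ]
    ring
  have hl₀ : 0 ≤ l := Real.log_nonneg hcard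
  calc N * (3 * δ) = 14.52 / φ * (ε * N) := h₁
    _ ≤ 14.52 / φ * (4 * ε * l / φ) := mul_le_mul_of_nonneg_left hεN (by positivity)
    _ = 58.08 * (ε * l / φ ^ 2) := by ring
    _ ≤ 60 * (ε * l / φ ^ 2) := mul_le_mul_of_nonneg_right (by norm_num) (by positivity)
    _ = 60 * ε * l / φ ^ 2 := by ring
end

section
/- Let G be a weighted undirected graph with weighted Laplacian L_G, degree diagonal D_G (positive), and normalized Laplacian N_G = D_G^{−1/2} L_G D_G^{−1/2}. If λ₂(N_Ḡ) denotes the second-smallest eigenvalue of the normalized Laplacian of G and φ(G) its conductance, then φ(G)²/2 ≤ λ₂(N_G) ≤ 2·φ(G). -/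
open Matrix

/-- Any two reals admit a nontrivial linear relation. -/
lemma exists_nontrivial_linear_relation (p q : ℝ) :
    ∃ a b : ℝ, 0 < a ^ 2 + b ^ 2 ∧ a * p + b * q = 0 := by
  by_cases hp : p = 0
  · exact ⟨1, 0, by norm_num, by simp [hp]⟩
  · exact ⟨q, -p, add_pos_of_nonneg_of_pos (sq_nonneg q) (by simpa using sq_pos_of_ne_zero hp), by ring⟩

section Spectral

variable {V ι : Type*} [Fintype V] [Fintype ι] [DecidableEq ι]

/-- Parseval's identity for an orthonormal family of full cardinality. -/
lemma sum_dotProduct_mul_dotProduct [DecidableEq V] (hc : Fintype.card ι = Fintype.card V)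
    (u : ι → V → ℝ) (horth : ∀ i j, u i ⬝ᵥ u j = if i = j then (1 : ℝ) else 0)
    (x y : V → ℝ) : ∑ i, (u i ⬝ᵥ x) * (u i ⬝ᵥ y) = x ⬝ᵥ y := by
  have h1 : (Matrix.of u) * (Matrix.of u)ᵀ = 1 := by
    ext i j
    simpa [Matrix.mul_apply, Matrix.one_apply, dotProduct] using horth i j
  have h2 : (Matrix.of u)ᵀ * (Matrix.of u) = 1 :=
    (Matrix.mul_eq_one_comm_of_card_eq _ _ _ hc).1 h1
  have h3 : (Matrix.of u *ᵥ x) ⬝ᵥ (Matrix.of u *ᵥ y) = x ⬝ᵥ y := by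
    rw [Matrix.dotProduct_mulVec, Matrix.vecMul_mulVec, ← Matrix.dotProduct_mulVec, h2,
      Matrix.one_mulVec]
  exact h3

/-- Rayleigh bound from below on the orthogonal complement of the eigenvectors whose eigenvalue
is smaller than `l`. -/
lemma mul_dotProduct_self_le_of_eigenbasis [DecidableEq V]
    (hc : Fintype.card ι = Fintype.card V) (N : Matrix V V ℝ) (hNs : Nᵀ = N)
    (u : ι → V → ℝ) (lam : ι → ℝ) (heig : ∀ i, N *ᵥ u i = lam i • u i)
    (horth : ∀ i j, u i ⬝ᵥ u j = if i = j then (1 : ℝ) else 0)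
    (l : ℝ) (x : V → ℝ) (hx : ∀ i, lam i < l → u i ⬝ᵥ x = 0) :
    l * (x ⬝ᵥ x) ≤ x ⬝ᵥ N *ᵥ x := by
  have h : ∀ i, u i ⬝ᵥ N *ᵥ x = lam i * (u i ⬝ᵥ x) := fun i => by
    rw [Matrix.dotProduct_mulVec, ← Matrix.mulVec_transpose, hNs, heig, smul_dotProduct,
      smul_eq_mul]
  rw [← sum_dotProduct_mul_dotProduct hc u horth x x,
    ← sum_dotProduct_mul_dotProduct hc u horth x (N *ᵥ x), Finset.mul_sum]
  refine Finset.sum_le_sum fun i _ => ?_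
  rw [h]
  rcases lt_or_ge (lam i) l with hi | hi
  · simp [hx i hi]
  · nlinarith [mul_nonneg (sub_nonneg.2 hi) (mul_self_nonneg (u i ⬝ᵥ x))]

end Spectral

section Graph

variable {V : Type*} [Fintype V]

/-- A weighted median of a function on a finite set. -/
lemma exists_weighted_median [Nonempty V] (deg : V → ℝ) (hdeg : ∀ u, 0 ≤ deg u) (f : V → ℝ) :
    ∃ c : ℝ, 2 * ∑ u with c < f u, deg u ≤ ∑ u, deg u ∧
      2 * ∑ u with f u < c, deg u ≤ ∑ u, deg u := by
  classical
  obtain ⟨m, -, hm⟩ := Finset.exists_max_image Finset.univ f Finset.univ_nonempty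
  let A : Finset V := {a | 2 * ∑ u with f a < f u, deg u ≤ ∑ u, deg u}
  have hmA : m ∈ A := by
    have : ({u | f m < f u} : Finset V) = ∅ := by
      ext u
      simpa using hm u (Finset.mem_univ u)
    simp only [A, Finset.mem_filter, Finset.mem_univ, true_and, this, Finset.sum_empty, mul_zero]
    exact Finset.sum_nonneg fun u _ => hdeg u
  obtain ⟨a, haA, ha⟩ := Finset.exists_min_image A f ⟨m, hmA⟩
  refine ⟨f a, (Finset.mem_filter.1 haA).2, ?_⟩
  rcases ({u | f u < f a} : Finset V).eq_empty_or_nonempty with he | hne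
  · rw [he, Finset.sum_empty, mul_zero]
    exact Finset.sum_nonneg fun u _ => hdeg u
  obtain ⟨b, hbB, hb⟩ := Finset.exists_max_image _ f hne
  have hba : f b < f a := (Finset.mem_filter.1 hbB).2
  have hbA : b ∉ A := fun h => absurd (ha b h) (not_le.2 hba)
  simp only [A, Finset.mem_filter, Finset.mem_univ, true_and, not_le] at hbA
  have hcompl : ({u | f b < f u} : Finset V) = ({u | ¬ f u < f a} : Finset V) := by
    ext u
    simp only [Finset.mem_filter, Finset.mem_univ, true_and]
    constructor
    · intro h h'
      exact absurd (hb u (by simpa using h')) (not_le.2 h)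
    · intro h
      exact hba.trans_le (not_lt.1 h)
  rw [hcompl] at hbA
  have := Finset.sum_filter_add_sum_filter_not Finset.univ (fun u => f u < f a) deg
  linarith

/-- Layer-cake inequality: an isoperimetric inequality for small sets extends to nonnegative
functions of small support. -/
lemma mul_sum_le_sum_max_sub [DecidableEq V] (w : V → V → ℝ) (deg : V → ℝ)
    (hdeg : ∀ u, 0 ≤ deg u) (φ : ℝ)
    (hiso : ∀ S : Finset V, S.Nonempty → 2 * ∑ u ∈ S, deg u ≤ ∑ u, deg u →
      φ * ∑ u ∈ S, deg u ≤ ∑ u ∈ S, ∑ v ∈ Sᶜ, w u v)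
    (k : V → ℝ) (hk : ∀ u, 0 ≤ k u) (hsupp : 2 * ∑ u with 0 < k u, deg u ≤ ∑ u, deg u) :
    φ * ∑ u, deg u * k u ≤ ∑ u, ∑ v, w u v * max (k u - k v) 0 := by
  induction hn : ({u | 0 < k u} : Finset V).card using Nat.strong_induction_on generalizing k with
  | _ n ih =>
  let S : Finset V := {u | 0 < k u}
  have hS : ∀ u, u ∈ S ↔ 0 < k u := fun u => by simp [S]
  have hS0 : ∀ u, u ∉ S → k u = 0 := fun u hu =>
    le_antisymm (not_lt.1 fun h => hu ((hS u).2 h)) (hk u)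
  rcases S.eq_empty_or_nonempty with he | hne
  · have : ∀ u, k u = 0 := fun u => hS0 u (by simp [he])
    simp [this]
  obtain ⟨a, haS, ha⟩ := Finset.exists_min_image S k hne
  have hka := (hS a).1 haS
  let k' : V → ℝ := fun u => k u - if u ∈ S then k a else 0
  have hk' : ∀ u, 0 ≤ k' u := fun u => by
    by_cases hu : u ∈ S
    · simpa [k', hu] using ha u hu
    · simpa [k', hu] using hk u
  have hsub : ({u | 0 < k' u} : Finset V) ⊂ S := by
    refine (Finset.ssubset_iff_of_subset fun u hu => ?_).2 ⟨a, haS, by simp [k', haS]⟩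
    by_contra hu'
    simp [k', hu', hS0 u hu'] at hu
  have hsum' : ∑ u with 0 < k' u, deg u ≤ ∑ u ∈ S, deg u :=
    Finset.sum_le_sum_of_subset_of_nonneg hsub.subset fun u _ _ => hdeg u
  have hrec := ih _ (hn ▸ Finset.card_lt_card hsub) k' hk' (by linarith) rfl
  have e1 : ∑ u, deg u * k u = ∑ u, deg u * k' u + k a * ∑ u ∈ S, deg u := by
    rw [← Fintype.sum_ite_mem S deg, Finset.mul_sum, ← Finset.sum_add_distrib]
    refine Finset.sum_congr rfl fun u _ => ?_
    simp only [k']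
    split_ifs <;> ring
  have e2 : ∑ u, ∑ v, w u v * max (k u - k v) 0
      = ∑ u, ∑ v, w u v * max (k' u - k' v) 0 + k a * ∑ u ∈ S, ∑ v ∈ Sᶜ, w u v := by
    rw [← Fintype.sum_ite_mem S, Finset.mul_sum, ← Finset.sum_add_distrib]
    refine Finset.sum_congr rfl fun u _ => ?_
    by_cases hu : u ∈ S
    · rw [if_pos hu, ← Fintype.sum_ite_mem Sᶜ, Finset.mul_sum, ← Finset.sum_add_distrib]
      refine Finset.sum_congr rfl fun v _ => ?_
      by_cases hv : v ∈ S
      · simp [k', hu, hv]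
      · have h1 := ha u hu
        simp only [k', hu, hv, hS0 v hv, Finset.mem_compl, not_false_eq_true, if_true, if_false,
          sub_zero]
        rw [max_eq_left (hk u), max_eq_left (by linarith)]
        ring
    · rw [if_neg hu, mul_zero, add_zero]
      refine Finset.sum_congr rfl fun v _ => ?_
      have h1 := hk v
      have h2 := hk' v
      have h3 : k' u = 0 := by simp [k', hu, hS0 u hu]
      rw [hS0 u hu, h3, max_eq_right (by linarith), max_eq_right (by linarith)]
  have h := mul_le_mul_of_nonneg_left (hiso S hne hsupp) hka.le
  rw [e1, e2]
  linarith

/-- The Dirichlet form in terms of degrees. -/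
lemma sum_sum_mul_sub_sq (w : V → V → ℝ) (hsymm : ∀ u v, w u v = w v u) (deg : V → ℝ)
    (hdeg : ∀ u, deg u = ∑ v, w u v) (s : ℝ) (f : V → ℝ) :
    ∑ u, ∑ v, w u v * (f u + s * f v) ^ 2
      = (1 + s ^ 2) * ∑ u, deg u * f u ^ 2 + 2 * s * ∑ u, ∑ v, f u * w u v * f v := by
  have h1 : ∑ u, ∑ v, w u v * f u ^ 2 = ∑ u, deg u * f u ^ 2 :=
    Finset.sum_congr rfl fun u _ => by rw [hdeg, Finset.sum_mul]
  have h2 : ∑ u, ∑ v, w u v * f v ^ 2 = ∑ u, deg u * f u ^ 2 := by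
    rw [Finset.sum_comm, ← h1]
    exact Finset.sum_congr rfl fun u _ => Finset.sum_congr rfl fun v _ => by rw [hsymm]
  calc _ = ∑ u, ∑ v, w u v * f u ^ 2 + s ^ 2 * ∑ u, ∑ v, w u v * f v ^ 2
        + 2 * s * ∑ u, ∑ v, f u * w u v * f v := by
        simp only [Finset.mul_sum, ← Finset.sum_add_distrib]
        exact Finset.sum_congr rfl fun u _ => Finset.sum_congr rfl fun v _ => by ring
    _ = _ := by rw [h1, h2]; ring

/-- Cheeger's inequality for a nonnegative function supported on at most half of the volume. -/
lemma sq_mul_sum_le_sum_of_small_support [DecidableEq V] (w : V → V → ℝ)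
    (hsymm : ∀ u v, w u v = w v u) (hnonneg : ∀ u v, 0 ≤ w u v) (deg : V → ℝ)
    (hdeg : ∀ u, deg u = ∑ v, w u v) (φ : ℝ) (hφ : 0 ≤ φ)
    (hiso : ∀ S : Finset V, S.Nonempty → 2 * ∑ u ∈ S, deg u ≤ ∑ u, deg u →
      φ * ∑ u ∈ S, deg u ≤ ∑ u ∈ S, ∑ v ∈ Sᶜ, w u v)
    (h : V → ℝ) (hh : ∀ u, 0 ≤ h u) (hsupp : 2 * ∑ u with 0 < h u, deg u ≤ ∑ u, deg u) :
    φ ^ 2 * ∑ u, deg u * h u ^ 2 ≤ ∑ u, ∑ v, w u v * (h u - h v) ^ 2 := by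
  have hdeg0 : ∀ u, 0 ≤ deg u := fun u => hdeg u ▸ Finset.sum_nonneg fun v _ => hnonneg u v
  have hpos : ∀ u, 0 < h u ^ 2 ↔ 0 < h u := fun u =>
    ⟨fun h' => (hh u).lt_of_ne fun e => by simp [← e] at h', fun h' => by positivity⟩
  have hco := mul_sum_le_sum_max_sub w deg hdeg0 φ hiso (fun u => h u ^ 2) (fun u => sq_nonneg _)
    (by simpa only [hpos] using hsupp)
  set M := ∑ u, deg u * h u ^ 2 with hM
  set E := ∑ u, ∑ v, w u v * (h u - h v) ^ 2 with hE
  have hM0 : 0 ≤ M := Finset.sum_nonneg fun u _ => mul_nonneg (hdeg0 u) (sq_nonneg _)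
  have hE0 : 0 ≤ E := Finset.sum_nonneg fun u _ => Finset.sum_nonneg fun v _ =>
    mul_nonneg (hnonneg u v) (sq_nonneg _)
  have habs : 2 * ∑ u, ∑ v, w u v * max (h u ^ 2 - h v ^ 2) 0
      = ∑ u, ∑ v, w u v * |h u ^ 2 - h v ^ 2| := by
    have hswap : ∑ u, ∑ v, w u v * max (h u ^ 2 - h v ^ 2) 0
        = ∑ u, ∑ v, w u v * max (h v ^ 2 - h u ^ 2) 0 := by
      rw [Finset.sum_comm]
      exact Finset.sum_congr rfl fun u _ => Finset.sum_congr rfl fun v _ => by rw [hsymm]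
    rw [two_mul]
    nth_rewrite 2 [hswap]
    simp only [← Finset.sum_add_distrib]
    refine Finset.sum_congr rfl fun u _ => Finset.sum_congr rfl fun v _ => ?_
    rcases le_total (h u ^ 2) (h v ^ 2) with h' | h'
    · rw [max_eq_right (by linarith), max_eq_left (by linarith), abs_of_nonpos (by linarith)]
      ring
    · rw [max_eq_left (by linarith), max_eq_right (by linarith), abs_of_nonneg (by linarith)]
      ring
  have hplus : ∑ u, ∑ v, w u v * (h u + h v) ^ 2 ≤ 4 * M := by
    have h1 := sum_sum_mul_sub_sq w hsymm deg hdeg 1 h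
    have h2 := sum_sum_mul_sub_sq w hsymm deg hdeg (-1) h
    simp only [one_mul, neg_mul, ← sub_eq_add_neg] at h1 h2
    rw [← hM] at h1 h2
    rw [← hE] at h2
    linarith
  have hcs : (∑ u, ∑ v, w u v * |h u ^ 2 - h v ^ 2|) ^ 2
      ≤ E * ∑ u, ∑ v, w u v * (h u + h v) ^ 2 := by
    simp only [hE, ← Fintype.sum_prod_type']
    refine Finset.sum_sq_le_sum_mul_sum_of_sq_le_mul _
      (fun p _ => mul_nonneg (hnonneg _ _) (sq_nonneg _))
      (fun p _ => mul_nonneg (hnonneg _ _) (sq_nonneg _)) fun p _ => ?_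
    rw [mul_pow, sq_abs]
    apply le_of_eq
    ring
  have hfin : (2 * (φ * M)) ^ 2 ≤ E * (4 * M) := by
    refine le_trans (pow_le_pow_left₀ (by positivity) ?_ 2)
      (hcs.trans (mul_le_mul_of_nonneg_left hplus hE0))
    linarith
  rcases hM0.eq_or_lt with h0 | h0
  · rw [← h0, mul_zero]
    exact hE0
  · refine le_of_mul_le_mul_right ?_ h0
    nlinarith

/-- Cheeger's inequality for a function of mean zero. -/
lemma sq_mul_sum_le_sum_of_mean_zero [DecidableEq V] [Nonempty V] (w : V → V → ℝ)
    (hsymm : ∀ u v, w u v = w v u) (hnonneg : ∀ u v, 0 ≤ w u v) (deg : V → ℝ)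
    (hdeg : ∀ u, deg u = ∑ v, w u v) (φ : ℝ) (hφ : 0 ≤ φ)
    (hiso : ∀ S : Finset V, S.Nonempty → 2 * ∑ u ∈ S, deg u ≤ ∑ u, deg u →
      φ * ∑ u ∈ S, deg u ≤ ∑ u ∈ S, ∑ v ∈ Sᶜ, w u v)
    (f : V → ℝ) (hf : ∑ u, deg u * f u = 0) :
    φ ^ 2 * ∑ u, deg u * f u ^ 2 ≤ ∑ u, ∑ v, w u v * (f u - f v) ^ 2 := by
  have hdeg0 : ∀ u, 0 ≤ deg u := fun u => hdeg u ▸ Finset.sum_nonneg fun v _ => hnonneg u v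
  obtain ⟨c, hc1, hc2⟩ := exists_weighted_median deg hdeg0 f
  have hp := sq_mul_sum_le_sum_of_small_support w hsymm hnonneg deg hdeg φ hφ hiso
    (fun u => max (f u - c) 0) (fun u => le_max_right _ _)
    (by simpa only [lt_max_iff, lt_irrefl, or_false, sub_pos] using hc1)
  have hm := sq_mul_sum_le_sum_of_small_support w hsymm hnonneg deg hdeg φ hφ hiso
    (fun u => max (c - f u) 0) (fun u => le_max_right _ _)
    (by simpa only [lt_max_iff, lt_irrefl, or_false, sub_pos] using hc2)
  have hmass : ∑ u, deg u * f u ^ 2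
      ≤ ∑ u, deg u * max (f u - c) 0 ^ 2 + ∑ u, deg u * max (c - f u) 0 ^ 2 := by
    have h1 : ∑ u, deg u * f u ^ 2 + c ^ 2 * ∑ u, deg u - 2 * c * ∑ u, deg u * f u
        = ∑ u, deg u * max (f u - c) 0 ^ 2 + ∑ u, deg u * max (c - f u) 0 ^ 2 := by
      simp only [Finset.mul_sum, ← Finset.sum_add_distrib, ← Finset.sum_sub_distrib]
      refine Finset.sum_congr rfl fun u _ => ?_
      rcases le_total (f u) c with h' | h'
      · rw [max_eq_right (by linarith), max_eq_left (by linarith)]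
        ring
      · rw [max_eq_left (by linarith), max_eq_right (by linarith)]
        ring
    have h2 : 0 ≤ c ^ 2 * ∑ u, deg u :=
      mul_nonneg (sq_nonneg _) (Finset.sum_nonneg fun u _ => hdeg0 u)
    rw [hf] at h1
    linarith
  have henergy : ∑ u, ∑ v, w u v * (max (f u - c) 0 - max (f v - c) 0) ^ 2
      + ∑ u, ∑ v, w u v * (max (c - f u) 0 - max (c - f v) 0) ^ 2
      ≤ ∑ u, ∑ v, w u v * (f u - f v) ^ 2 := by
    simp only [← Finset.sum_add_distrib]
    refine Finset.sum_le_sum fun u _ => Finset.sum_le_sum fun v _ => ?_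
    rw [← mul_add]
    refine mul_le_mul_of_nonneg_left ?_ (hnonneg u v)
    rcases le_total (f u) c with h1 | h1 <;> rcases le_total (f v) c with h2 | h2
    · rw [max_eq_right (by linarith), max_eq_right (by linarith), max_eq_left (by linarith),
        max_eq_left (by linarith)]
      apply le_of_eq
      ring
    · rw [max_eq_right (by linarith), max_eq_left (by linarith), max_eq_left (by linarith),
        max_eq_right (by linarith)]
      nlinarith [mul_nonneg (sub_nonneg.2 h1) (sub_nonneg.2 h2)]
    · rw [max_eq_left (by linarith), max_eq_right (by linarith), max_eq_right (by linarith),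
        max_eq_left (by linarith)]
      nlinarith [mul_nonneg (sub_nonneg.2 h1) (sub_nonneg.2 h2)]
    · rw [max_eq_left (by linarith), max_eq_left (by linarith), max_eq_right (by linarith),
        max_eq_right (by linarith)]
      apply le_of_eq
      ring
  have := mul_le_mul_of_nonneg_left hmass (sq_nonneg φ)
  linarith

/-- The quadratic form of the normalized Laplacian. -/
lemma two_mul_dotProduct_normalized_laplacian [DecidableEq V] (w : V → V → ℝ)
    (hsymm : ∀ u v, w u v = w v u) (deg : V → ℝ) (hdeg : ∀ u, deg u = ∑ v, w u v)
    (hdegpos : ∀ u, 0 < deg u) (N : Matrix V V ℝ)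
    (hN : ∀ u v, N u v = ((if u = v then deg u else 0) - w u v) / (√(deg u) * √(deg v)))
    (f : V → ℝ) :
    2 * ((fun u => √(deg u) * f u) ⬝ᵥ N *ᵥ fun u => √(deg u) * f u)
      = ∑ u, ∑ v, w u v * (f u - f v) ^ 2 := by
  have h2 := sum_sum_mul_sub_sq w hsymm deg hdeg (-1) f
  simp only [neg_mul, one_mul, ← sub_eq_add_neg] at h2
  have h3 : (fun u => √(deg u) * f u) ⬝ᵥ (N *ᵥ fun u => √(deg u) * f u)
      = ∑ u, deg u * f u ^ 2 - ∑ u, ∑ v, f u * w u v * f v := by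
    simp only [dotProduct, mulVec, Finset.mul_sum, ← Finset.sum_sub_distrib]
    refine Finset.sum_congr rfl fun u _ => ?_
    have : deg u * f u ^ 2 = ∑ v, if u = v then f u * deg u * f v else 0 := by
      rw [Finset.sum_ite_eq, if_pos (Finset.mem_univ u)]
      ring
    rw [this, ← Finset.sum_sub_distrib]
    refine Finset.sum_congr rfl fun v _ => ?_
    have hu := (Real.sqrt_pos.2 (hdegpos u)).ne'
    have hv := (Real.sqrt_pos.2 (hdegpos v)).ne'
    rw [hN]
    split_ifs <;> field_simp
    all_goals ring
  rw [h2, h3]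
  ring

end Graph

/-- Cheeger's inequality. For a connected weighted undirected graph
with positive degrees, weighted Laplacian `L`, normalized Laplacian
`N = D^{-1/2} L D^{-1/2}`, and conductance `φ` (the minimum over nonempty proper vertex
subsets `S` of `cut(S) / min(vol S, vol Sᶜ)`), the second-smallest eigenvalue `λ₂` of `N`
satisfies `φ²/2 ≤ λ₂ ≤ 2φ`. -/
theorem stmt_16 {V : Type*} [Fintype V] [DecidableEq V]
    (w : V → V → ℝ) (hsymm : ∀ u v, w u v = w v u) (hnonneg : ∀ u v, 0 ≤ w u v)
    (hdiag : ∀ u, w u u = 0)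
    (hconn : (SimpleGraph.fromRel (fun u v => 0 < w u v)).Connected)
    (deg : V → ℝ) (hdeg : ∀ u, deg u = ∑ v, w u v) (hdegpos : ∀ u, 0 < deg u)
    (L : Matrix V V ℝ) (hL : ∀ u v, L u v = (if u = v then deg u else 0) - w u v)
    (N : Matrix V V ℝ)
    (hN : ∀ u v, N u v = L u v / (Real.sqrt (deg u) * Real.sqrt (deg v)))
    (vol : Finset V → ℝ) (hvol : ∀ S, vol S = ∑ u ∈ S, deg u)
    (cut : Finset V → ℝ) (hcut : ∀ S, cut S = ∑ u ∈ S, ∑ v ∈ Sᶜ, w u v)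
    (φ : ℝ)
    (hφ : IsLeast {x : ℝ | ∃ S : Finset V, S.Nonempty ∧ S ≠ Finset.univ ∧
      x = cut S / min (vol S) (vol Sᶜ)} φ)
    (hcard : 2 ≤ Fintype.card V)
    (lam : Fin (Fintype.card V) → ℝ) (u : Fin (Fintype.card V) → V → ℝ)
    (hmono : Monotone lam)
    (heig : ∀ i, N.mulVec (u i) = lam i • u i)
    (horth : ∀ i j, u i ⬝ᵥ u j = if i = j then (1 : ℝ) else 0) :
    φ ^ 2 / 2 ≤ lam ⟨1, by omega⟩ ∧ lam ⟨1, by omega⟩ ≤ 2 * φ := by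
  classical
  have hV : Nonempty V := Fintype.card_pos_iff.1 (by omega)
  have hsq : ∀ a, √(deg a) ^ 2 = deg a := fun a => Real.sq_sqrt (hdegpos a).le
  have hquad := two_mul_dotProduct_normalized_laplacian w hsymm deg hdeg hdegpos N
    (fun a b => by rw [hN, hL])
  have hself : ∀ f : V → ℝ, (fun a => √(deg a) * f a) ⬝ᵥ (fun a => √(deg a) * f a)
      = ∑ a, deg a * f a ^ 2 := fun f =>
    Finset.sum_congr rfl fun a _ => by rw [← sq, mul_pow, hsq]
  have hvolpos : ∀ S : Finset V, S.Nonempty → 0 < vol S := fun S hS => by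
    rw [hvol]
    exact Finset.sum_pos (fun a _ => hdegpos a) hS
  have hvolc : ∀ S, vol S + vol Sᶜ = ∑ a, deg a := fun S => by
    rw [hvol, hvol, Finset.sum_add_sum_compl]
  have hcut0 : ∀ S, 0 ≤ cut S := fun S => by
    rw [hcut]
    exact Finset.sum_nonneg fun a _ => Finset.sum_nonneg fun b _ => hnonneg a b
  obtain ⟨⟨S, hSne, hSuniv, hS⟩, hmin⟩ := hφ
  have hSc : Sᶜ.Nonempty := by
    rwa [Finset.nonempty_iff_ne_empty, Ne, Finset.compl_eq_empty_iff]
  have hmpos : 0 < min (vol S) (vol Sᶜ) := lt_min (hvolpos S hSne) (hvolpos _ hSc)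
  have hφ0 : 0 ≤ φ := hS ▸ div_nonneg (hcut0 S) hmpos.le
  set i₀ : Fin (Fintype.card V) := ⟨0, by omega⟩ with hi₀
  set i₁ : Fin (Fintype.card V) := ⟨1, by omega⟩ with hi₁
  have hle : lam i₀ ≤ lam i₁ := hmono (by simp [hi₀, hi₁])
  have hne : i₀ ≠ i₁ := by simp [hi₀, hi₁]
  constructor
  · have hiso : ∀ T : Finset V, T.Nonempty → 2 * ∑ a ∈ T, deg a ≤ ∑ a, deg a →
        φ * ∑ a ∈ T, deg a ≤ ∑ a ∈ T, ∑ b ∈ Tᶜ, w a b := fun T hT hhalf => by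
      rw [← hvol, ← hvolc T] at hhalf
      have hTpos := hvolpos T hT
      have hTu : T ≠ Finset.univ := by
        rintro rfl
        have : vol (Finset.univᶜ : Finset V) = 0 := by simp [hvol]
        linarith
      have h := hmin ⟨T, hT, hTu, rfl⟩
      rw [min_eq_left (by linarith), le_div_iff₀ hTpos] at h
      rwa [← hvol, ← hcut]
    obtain ⟨a, b, hab, hlin⟩ := exists_nontrivial_linear_relation
      (∑ v, √(deg v) * u i₀ v) (∑ v, √(deg v) * u i₁ v)
    let f : V → ℝ := fun v => (a * u i₀ v + b * u i₁ v) / √(deg v)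
    have hx : (fun v => √(deg v) * f v) = a • u i₀ + b • u i₁ := by
      ext v
      have := (Real.sqrt_pos.2 (hdegpos v)).ne'
      simp only [f, Pi.add_apply, Pi.smul_apply, smul_eq_mul]
      field_simp
    have hf : ∑ v, deg v * f v = 0 := by
      rw [← hlin, Finset.mul_sum, Finset.mul_sum, ← Finset.sum_add_distrib]
      refine Finset.sum_congr rfl fun v _ => ?_
      have h := congrFun hx v
      simp only [Pi.add_apply, Pi.smul_apply, smul_eq_mul] at h
      calc deg v * f v = √(deg v) * (√(deg v) * f v) := by rw [← mul_assoc, ← sq, hsq]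
        _ = _ := by rw [h]; ring
    have hmain := sq_mul_sum_le_sum_of_mean_zero w hsymm hnonneg deg hdeg φ hφ0 hiso f hf
    rw [← hself, ← hquad, hx] at hmain
    simp only [mulVec_add, mulVec_smul, heig, dotProduct_add, add_dotProduct, smul_dotProduct,
      dotProduct_smul, horth, hne, hne.symm, if_true, if_false, smul_eq_mul] at hmain
    have h1 := mul_le_mul_of_nonneg_left hle (sq_nonneg a)
    refine le_of_mul_le_mul_right ?_ hab
    linarith
  · obtain ⟨a, b, hab, hlin⟩ := exists_nontrivial_linear_relation
      (∑ v ∈ S, u i₀ v * √(deg v)) (∑ v ∈ Sᶜ, u i₀ v * √(deg v))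
    let f : V → ℝ := fun v => if v ∈ S then a else b
    have hfS : ∀ v ∈ S, f v = a := fun v hv => by simp [f, hv]
    have hfc : ∀ v ∈ Sᶜ, f v = b := fun v hv => by simp [f, Finset.mem_compl.1 hv]
    have horth₀ : u i₀ ⬝ᵥ (fun v => √(deg v) * f v) = 0 := by
      rw [← hlin, dotProduct, ← Finset.sum_add_sum_compl S, Finset.mul_sum, Finset.mul_sum]
      congr 1
      · exact Finset.sum_congr rfl fun v hv => by rw [hfS v hv]; ring
      · exact Finset.sum_congr rfl fun v hv => by rw [hfc v hv]; ring
    have hNs : Nᵀ = N := by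
      ext v v'
      rw [transpose_apply, hN, hN, hL, hL, hsymm v' v, mul_comm]
      rcases eq_or_ne v v' with rfl | h
      · rfl
      · simp [h, h.symm]
    have hray := mul_dotProduct_self_le_of_eigenbasis (Fintype.card_fin _) N hNs u lam heig horth
      (lam i₁) (fun v => √(deg v) * f v) (fun i hi => by
        have : i < i₁ := hmono.reflect_lt hi
        have : i = i₀ := by
          rw [Fin.lt_def] at this
          ext
          simp only [hi₀, hi₁] at this ⊢
          omega
        rwa [this])
    have hnorm : ∑ v, deg v * f v ^ 2 = a ^ 2 * vol S + b ^ 2 * vol Sᶜ := by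
      rw [← Finset.sum_add_sum_compl S, hvol, hvol, Finset.mul_sum, Finset.mul_sum]
      congr 1
      · exact Finset.sum_congr rfl fun v hv => by rw [hfS v hv]; ring
      · exact Finset.sum_congr rfl fun v hv => by rw [hfc v hv]; ring
    have hcut' : cut S = ∑ v ∈ Sᶜ, ∑ v' ∈ S, w v v' := by
      rw [hcut, Finset.sum_comm]
      exact Finset.sum_congr rfl fun v _ => Finset.sum_congr rfl fun v' _ => hsymm _ _
    have henergy : ∑ v, ∑ v', w v v' * (f v - f v') ^ 2 = 2 * ((a - b) ^ 2 * cut S) := by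
      rw [two_mul, ← Finset.sum_add_sum_compl S]
      congr 1
      · rw [hcut, Finset.mul_sum]
        refine Finset.sum_congr rfl fun v hv => ?_
        rw [← Finset.sum_add_sum_compl S, Finset.mul_sum, Finset.sum_eq_zero, zero_add]
        · exact Finset.sum_congr rfl fun v' hv' => by rw [hfS v hv, hfc v' hv']; ring
        · intro v' hv'
          rw [hfS v hv, hfS v' hv', sub_self]
          ring
      · rw [hcut', Finset.mul_sum]
        refine Finset.sum_congr rfl fun v hv => ?_
        rw [← Finset.sum_compl_add_sum S, Finset.mul_sum, Finset.sum_eq_zero, zero_add]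
        · exact Finset.sum_congr rfl fun v' hv' => by rw [hfc v hv, hfS v' hv']; ring
        · intro v' hv'
          rw [hfc v hv, hfc v' hv', sub_self]
          ring
    have hq := hquad f
    rw [henergy] at hq
    rw [hself, hnorm] at hray
    set m := min (vol S) (vol Sᶜ) with hm
    have hcm : cut S = φ * m := by rw [hS, div_mul_cancel₀ _ hmpos.ne']
    have h1 : (a ^ 2 + b ^ 2) * m ≤ a ^ 2 * vol S + b ^ 2 * vol Sᶜ := by
      have h2 := mul_le_mul_of_nonneg_left (min_le_left (vol S) (vol Sᶜ)) (sq_nonneg a)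
      have h3 := mul_le_mul_of_nonneg_left (min_le_right (vol S) (vol Sᶜ)) (sq_nonneg b)
      rw [add_mul]
      exact add_le_add h2 h3
    have h2 : (a - b) ^ 2 * (φ * m) ≤ 2 * (a ^ 2 + b ^ 2) * (φ * m) :=
      mul_le_mul_of_nonneg_right (by nlinarith [sq_nonneg (a + b)]) (by positivity)
    have h3 := mul_le_mul_of_nonneg_left h1 hφ0
    refine le_of_mul_le_mul_right ?_ ((mul_pos hab hmpos).trans_le h1)
    rw [hcm] at hq
    linarith
end
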